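/- There is a constant C such that for every natural number n ≥ 3, the absolute value of (∑_{p ≤ n, p prime} 1/p) - ln(ln n) is at most C. That is, ∑_{p≤n} 1/p = ln(ln n) + O(1). -/

import Mathlib

open Finset Nat in
/-- The factorization of `n!`, in logarithmic form. -/
theorem log_factorial_eq_sum_primes (n : ℕ) :
    Real.log (n ! : ℕ) =
      ∑ p ∈ filter Nat.Prime (range (n + 1)), ((n !).factorization p : ℝ) * Real.log p := by
  rw [Real.log_nat_eq_sum_factorization, Finsupp.sum]
  refine sum_subset (fun p hp => ?_) (fun p _ hp => ?_)
  · have hp' := Nat.prime_of_mem_primeFactors hp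
    have := (hp'.dvd_factorial).1 (Nat.dvd_of_mem_primeFactors hp)
    simp [hp']
    omega
  · rw [Finsupp.notMem_support_iff.1 hp]
    simp

open Nat in
theorem div_sub_one_le_factorization_factorial {n p : ℕ} (hp : p.Prime) :
    (n : ℝ) / p - 1 ≤ (n !).factorization p := by
  have h : n / p ≤ (n !).factorization p := by
    rw [Nat.factorization_factorial hp (show Nat.log p n < Nat.log p n + 2 by omega)]
    simpa using Finset.single_le_sum (f := fun i => n / p ^ i) (fun _ _ => Nat.zero_le _)
      (show 1 ∈ Finset.Ico 1 (Nat.log p n + 2) by simp)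
  have h' : ((n / p : ℕ) : ℝ) ≤ (n !).factorization p := by exact_mod_cast h
  have := Nat.lt_floor_add_one ((n : ℝ) / p)
  rw [Nat.floor_div_eq_div] at this
  linarith

open Nat in
theorem factorization_factorial_le_div {n p : ℕ} (hp : p.Prime) :
    ((n !).factorization p : ℝ) ≤ n / (p - 1) := by
  have hp1 : (1 : ℝ) < p := by exact_mod_cast hp.one_lt
  have h : (p - 1) * (n !).factorization p ≤ n := by
    rw [Nat.sub_one_mul_factorization_factorial hp]
    exact Nat.sub_le _ _
  have h' : (((p - 1 : ℕ) : ℝ)) * (n !).factorization p ≤ n := by exact_mod_cast h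
  rw [Nat.cast_sub hp.one_le, Nat.cast_one] at h'
  rw [le_div_iff₀ (by linarith)]
  linarith

theorem log_div_mul_sub_one_le {x : ℝ} (hx : 2 ≤ x) :
    Real.log x / (x * (x - 1)) ≤ 4 * (1 / x ^ (3 / 2 : ℝ)) := by
  have hx0 : 0 < x := by linarith
  set s := x ^ (1 / 2 : ℝ) with hs
  have hs0 : 0 < s := by positivity
  have hss : s * s = x := by
    rw [hs, ← Real.rpow_add hx0]
    norm_num
  have h32 : x ^ (3 / 2 : ℝ) = x * s := by
    rw [hs, show (3 / 2 : ℝ) = 1 + 1 / 2 by norm_num, Real.rpow_add hx0, Real.rpow_one]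
  have hlog : Real.log x ≤ 2 * s := by
    have := Real.log_le_rpow_div hx0.le (show (0 : ℝ) < 1 / 2 by norm_num)
    rw [← hs] at this
    linarith
  rw [h32, mul_one_div, div_le_div_iff₀ (by nlinarith) (by positivity)]
  calc Real.log x * (x * s) ≤ 2 * s * (x * s) := by gcongr
    _ = 2 * x * x := by rw [← hss]; ring
    _ ≤ 4 * (x * (x - 1)) := by nlinarith

open Finset in
theorem exists_sum_log_div_mul_sub_one_le :
    ∃ K : ℝ, ∀ n : ℕ,
      ∑ p ∈ filter Nat.Prime (range (n + 1)), Real.log p / (p * ((p : ℝ) - 1)) ≤ K := by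
  have hsum : Summable fun k : ℕ => 4 * (1 / (k : ℝ) ^ (3 / 2 : ℝ)) :=
    (Real.summable_one_div_nat_rpow.2 (by norm_num)).mul_left 4
  refine ⟨∑' k : ℕ, 4 * (1 / (k : ℝ) ^ (3 / 2 : ℝ)), fun n => ?_⟩
  refine (sum_le_sum fun p hp => ?_).trans (hsum.sum_le_tsum _ fun _ _ => by positivity)
  exact log_div_mul_sub_one_le (by exact_mod_cast (mem_filter.1 hp).2.two_le)

open Finset Nat in
/-- Mertens' first theorem. -/
theorem mertens_first :
    ∃ K : ℝ, ∀ n : ℕ, 1 ≤ n →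
      |(∑ p ∈ filter Nat.Prime (range (n + 1)), Real.log p / p) - Real.log n| ≤ K := by
  obtain ⟨K, hK⟩ := exists_sum_log_div_mul_sub_one_le
  refine ⟨max (Real.log 4) (1 + K), fun n hn => ?_⟩
  have hn0 : (0 : ℝ) < n := by exact_mod_cast hn
  have hlower : n * Real.log n - n ≤ Real.log (n ! : ℕ) := by
    have h := Real.log_le_log (by positivity) (Real.pow_div_factorial_le_exp _ hn0.le n)
    rw [Real.log_div (by positivity) (by positivity), Real.log_pow, Real.log_exp] at h
    linarith
  have hupper : Real.log (n ! : ℕ) ≤ n * Real.log n := by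
    rw [← Real.log_pow]
    exact Real.log_le_log (by positivity) (by exact_mod_cast Nat.factorial_le_pow n)
  rw [log_factorial_eq_sum_primes] at hlower hupper
  set A := ∑ p ∈ filter Nat.Prime (range (n + 1)), Real.log p / p
  have h1 : ∑ p ∈ filter Nat.Prime (range (n + 1)), ((n !).factorization p : ℝ) * Real.log p
      ≤ n * (A + K) := by
    calc _ ≤ ∑ p ∈ filter Nat.Prime (range (n + 1)),
          n * (Real.log p / p + Real.log p / (p * ((p : ℝ) - 1))) := by
          refine sum_le_sum fun p hp => ?_
          have hp' := (mem_filter.1 hp).2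
          have hp1 : (1 : ℝ) < p := by exact_mod_cast hp'.one_lt
          have hp2 : (p : ℝ) - 1 ≠ 0 := by linarith
          refine (mul_le_mul_of_nonneg_right (factorization_factorial_le_div hp')
            (Real.log_nonneg hp1.le)).trans_eq ?_
          field_simp
          ring
      _ ≤ _ := by
          rw [← mul_sum, sum_add_distrib]
          gcongr
          exact hK n
  have h2 : n * A - n * Real.log 4 ≤
      ∑ p ∈ filter Nat.Prime (range (n + 1)), ((n !).factorization p : ℝ) * Real.log p := by
    have hθ := Chebyshev.theta_le_log4_mul_x hn0.le
    rw [Chebyshev.theta_eq_theta_coe_floor, Nat.floor_natCast,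
      Chebyshev.theta_eq_sum_primesLE_log, Nat.primesLE_eq_filter_range] at hθ
    calc n * A - n * Real.log 4
        ≤ n * A - ∑ p ∈ filter Nat.Prime (range (n + 1)), Real.log p := by linarith
      _ = ∑ p ∈ filter Nat.Prime (range (n + 1)), ((n : ℝ) / p - 1) * Real.log p := by
          rw [mul_sum, ← sum_sub_distrib]
          exact sum_congr rfl fun p _ => by ring
      _ ≤ _ := by
          refine sum_le_sum fun p hp => ?_
          have hp' := (mem_filter.1 hp).2
          exact mul_le_mul_of_nonneg_right (div_sub_one_le_factorization_factorial hp')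
            (Real.log_natCast_nonneg p)
  have h3 : Real.log n - 1 ≤ A + K := le_of_mul_le_mul_left (by linarith) hn0
  have h4 : A - Real.log 4 ≤ Real.log n := le_of_mul_le_mul_left (by linarith) hn0
  rw [abs_le]
  constructor
  · linarith [le_max_right (Real.log 4) (1 + K)]
  · linarith [le_max_left (Real.log 4) (1 + K)]

/-- The increment of `log` from `x` to `y` compared with its lower bound `(y - x) / y`. -/
theorem abs_sub_div_sub_log_sub_log_le {x y : ℝ} (hx : 0 < x) (hxy : x ≤ y) :
    |(y - x) / y - (Real.log y - Real.log x)| ≤ (y - x) * (1 / x - 1 / y) := by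
  have hy : 0 < y := hx.trans_le hxy
  have h1 := Real.log_le_sub_one_of_pos (div_pos hy hx)
  have h2 := Real.one_sub_inv_le_log_of_pos (div_pos hy hx)
  rw [Real.log_div hy.ne' hx.ne'] at h1 h2
  have e1 : y / x - 1 = (y - x) / y + (y - x) * (1 / x - 1 / y) := by field_simp; ring
  have e2 : 1 - (y / x)⁻¹ = (y - x) / y := by field_simp
  rw [abs_le]
  constructor <;> linarith [mul_nonneg (sub_nonneg.2 hxy)
    (sub_nonneg.2 (one_div_le_one_div_of_le hx hxy))]

/-- Partial summation: if `A` stays close to `log`, and `S` has increments those of `A` divided by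
`log`, then `S` stays close to `log ∘ log`. -/
theorem exists_abs_sub_log_log_le {A S : ℕ → ℝ} {K : ℝ}
    (hA : ∀ n, 1 ≤ n → |A n - Real.log n| ≤ K)
    (hS : ∀ n, 2 ≤ n → S (n + 1) - S n = (A (n + 1) - A n) / Real.log (n + 1 : ℕ)) :
    ∃ C : ℝ, ∀ n, 2 ≤ n → |S n - Real.log (Real.log n)| ≤ C := by
  have hK : 0 ≤ K := (abs_nonneg _).trans (hA 1 le_rfl)
  have hlog2 : 0 < Real.log 2 := Real.log_pos one_lt_two
  set T : ℕ → ℝ := fun n =>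
    S n - Real.log (Real.log n) - (A n - Real.log n) / Real.log n with hT
  set M := |T 2| + (1 + K) / Real.log 2
  have hTbound : ∀ n, 2 ≤ n → |T n| ≤ M - (1 + K) / Real.log n := by
    intro n hn
    induction n, hn using Nat.le_induction with
    | base => simp [M]
    | succ n hn ih =>
      have hn1 : (1 : ℝ) < n := by exact_mod_cast hn
      have hx : 0 < Real.log n := Real.log_pos hn1
      have hxy : Real.log n ≤ Real.log (n + 1 : ℕ) :=
        Real.log_le_log (by linarith) (by push_cast; linarith)
      have hstep : Real.log (n + 1 : ℕ) - Real.log n ≤ 1 := by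
        rw [← Real.log_div (by positivity) (by positivity)]
        refine (Real.log_le_sub_one_of_pos (by positivity)).trans ?_
        rw [sub_le_iff_le_add, div_le_iff₀ (by linarith)]
        push_cast
        linarith
      have hAn := hA n (by omega)
      have hSn := hS n hn
      simp only [hT] at ih ⊢
      set x := Real.log n
      set y := Real.log (n + 1 : ℕ)
      have hy : 0 < y := hx.trans_le hxy
      have hinv : 0 ≤ 1 / x - 1 / y := sub_nonneg.2 (one_div_le_one_div_of_le hx hxy)
      have hmain := abs_sub_div_sub_log_sub_log_le hx hxy
      have heq : S (n + 1) - Real.log y - (A (n + 1) - y) / y =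
          (S n - Real.log x - (A n - x) / x) +
            ((y - x) / y - (Real.log y - Real.log x)) + (A n - x) * (1 / x - 1 / y) := by
        rw [eq_add_of_sub_eq hSn]
        field_simp
        ring
      have h1 : (y - x) * (1 / x - 1 / y) ≤ 1 * (1 / x - 1 / y) := by gcongr
      have h2 : |(A n - x) * (1 / x - 1 / y)| ≤ K * (1 / x - 1 / y) := by
        rw [abs_mul, abs_of_nonneg hinv]
        gcongr
      have h3 : (1 + K) / x - (1 + K) / y = 1 * (1 / x - 1 / y) + K * (1 / x - 1 / y) := by ring
      rw [heq]
      refine (abs_add_three _ _ _).trans ?_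
      linarith
  refine ⟨M + K / Real.log 2, fun n hn => ?_⟩
  have hn2 : (2 : ℝ) ≤ n := by exact_mod_cast hn
  have hle : Real.log 2 ≤ Real.log n := Real.log_le_log two_pos hn2
  have hx : 0 < Real.log n := hlog2.trans_le hle
  have hR : |(A n - Real.log n) / Real.log n| ≤ K / Real.log 2 := by
    rw [abs_div, abs_of_pos hx]
    exact div_le_div₀ hK (hA n (by omega)) hlog2 hle
  have hTn : |T n| ≤ M := (hTbound n hn).trans (sub_le_self _ (by positivity))
  calc |S n - Real.log (Real.log n)| = |T n + (A n - Real.log n) / Real.log n| := by simp [hT]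
    _ ≤ M + K / Real.log 2 := (abs_add_le _ _).trans (add_le_add hTn hR)

theorem mertens_second : ∃ C : ℝ, ∀ n : ℕ, 3 ≤ n →
    |(∑ p ∈ Finset.filter Nat.Prime (Finset.range (n + 1)), (1 : ℝ) / p) -
      Real.log (Real.log n)| ≤ C := by
  obtain ⟨K, hK⟩ := mertens_first
  obtain ⟨C, hC⟩ := exists_abs_sub_log_log_le
    (S := fun n => ∑ p ∈ Finset.filter Nat.Prime (Finset.range (n + 1)), (1 : ℝ) / p) hK
    (fun n hn => by
      have hlog : Real.log (n + 1 : ℕ) ≠ 0 :=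
        (Real.log_pos (by exact_mod_cast (by omega : 1 < n + 1))).ne'
      simp only [Finset.sum_filter]
      rw [Finset.sum_range_succ _ (n + 1), Finset.sum_range_succ _ (n + 1),
        add_sub_cancel_left, add_sub_cancel_left]
      split_ifs
      · field_simp
      · simp)
  exact ⟨C, fun n hn => hC n (by omega)⟩
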